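/- Fix a probability measure π on Θ, a positive real constant λ and ε ∈ (0,1). Then with P-probability at least 1 − ε, simultaneously for every probability measure ρ on Θ with K(ρ,π) < ∞: ρ(R) ≤ Φ_{λ/N}^{-1}( ρ(r(·,ω)) + ( K(ρ,π) − log ε ) / λ ) ≤ ( λ / ( N (1 − exp(−λ/N)) ) ) ( ρ(r(·,ω)) + ( K(ρ,π) − log ε ) / λ ). -/

import Mathlib

open MeasureTheory ProbabilityTheory

/-- `Φ_a(p) = -a⁻¹ log(1 - (1 - e^{-a}) p)` for `a ≠ 0`, and `Φ_0(p) = p`. -/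
noncomputable def Phi (a p : ℝ) : ℝ :=
  if a = 0 then p else -a⁻¹ * Real.log (1 - (1 - Real.exp (-a)) * p)

/-- `Φ_a⁻¹(q) = (1 - e^{-aq})/(1 - e^{-a})` for `a ≠ 0`, and `Φ_0⁻¹(q) = q`. -/
noncomputable def PhiInv (a q : ℝ) : ℝ :=
  if a = 0 then q else (1 - Real.exp (-(a * q))) / (1 - Real.exp (-a))

/-- Kullback–Leibler divergence `K(ρ,π) = ∫ log (dρ/dπ) dρ` (as a real number;
meaningful under `KLFin ρ π`). -/
noncomputable def KL {Θ : Type*} [MeasurableSpace Θ] (ρ π : Measure Θ) : ℝ :=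
  ∫ θ, Real.log ((ρ.rnDeriv π θ).toReal) ∂ρ

/-- Finiteness of the Kullback–Leibler divergence: `ρ ≪ π` and `log (dρ/dπ)`
is `ρ`-integrable. -/
def KLFin {Θ : Type*} [MeasurableSpace Θ] (ρ π : Measure Θ) : Prop :=
  ρ ≪ π ∧ Integrable (fun θ => Real.log ((ρ.rnDeriv π θ).toReal)) ρ

/-- The Gibbs measure `π_{exp h}` with density `exp h / π[exp h]` with respect to `π`. -/
noncomputable def Gibbs {Θ : Type*} [MeasurableSpace Θ] (π : Measure Θ) (h : Θ → ℝ) :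
    Measure Θ :=
  (ENNReal.ofReal (∫ θ, Real.exp (h θ) ∂π))⁻¹ •
    π.withDensity (fun θ => ENNReal.ofReal (Real.exp (h θ)))

/-- Empirical error rate `r(θ,ω) = N⁻¹ ∑ᵢ 1[f_θ(X_i) ≠ Y_i]`. -/
noncomputable def empErr {𝒳 𝒴 Θ : Type*} [DecidableEq 𝒴] (N : ℕ)
    (f : Θ → 𝒳 → 𝒴) (θ : Θ) (ω : Fin N → 𝒳 × 𝒴) : ℝ :=
  (N : ℝ)⁻¹ * ∑ i, if f θ (ω i).1 = (ω i).2 then 0 else 1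

/-- Expected error rate `R(θ) = N⁻¹ ∑ᵢ P[f_θ(X_i) ≠ Y_i]`. -/
noncomputable def expErr {𝒳 𝒴 Θ : Type*} [MeasurableSpace 𝒳] [MeasurableSpace 𝒴] (N : ℕ)
    (P : Measure (Fin N → 𝒳 × 𝒴)) (f : Θ → 𝒳 → 𝒴) (θ : Θ) : ℝ :=
  (N : ℝ)⁻¹ * ∑ i, (P {ω | f θ (ω i).1 ≠ (ω i).2}).toReal

section

variable {Θ Ω : Type*} [MeasurableSpace Θ] [MeasurableSpace Ω]

lemma integral_le_integral_llr_add_log_integral_exp {ρ π : Measure Θ} [IsProbabilityMeasure ρ]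
    [IsProbabilityMeasure π] {h : Θ → ℝ} (hρπ : ρ ≪ π) (hρ : Integrable h ρ)
    (hπ : Integrable (fun θ => Real.exp (h θ)) π) (hllr : Integrable (llr ρ π) ρ) :
    ∫ θ, h θ ∂ρ ≤ ∫ θ, llr ρ π θ ∂ρ + Real.log (∫ θ, Real.exp (h θ) ∂π) := by
  have := isProbabilityMeasure_tilted hπ
  have h₁ := InformationTheory.integral_llr_add_sub_measure_univ_nonneg
    (hρπ.trans (absolutelyContinuous_tilted hπ)) (integrable_llr_tilted_right hρπ hρ hllr hπ)
  rw [integral_llr_tilted_right hρπ hρ hπ hllr] at h₁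
  simp only [probReal_univ] at h₁
  linarith

lemma measure_forall_integral_le_KL_sub_log {P : Measure Ω} [IsProbabilityMeasure P]
    {π : Measure Θ} [IsProbabilityMeasure π] {h : Θ → Ω → ℝ}
    (hm : Measurable (Function.uncurry h)) {B : ℝ} (hB : ∀ θ ω, |h θ ω| ≤ B)
    (hexp : ∀ θ, ∫ ω, Real.exp (h θ ω) ∂P ≤ 1) {ε : ℝ} (hε : ε ∈ Set.Ioo (0 : ℝ) 1) :
    ENNReal.ofReal (1 - ε) ≤
      P {ω | ∀ ρ : Measure Θ, IsProbabilityMeasure ρ → KLFin ρ π →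
        ∫ θ, h θ ω ∂ρ ≤ KL ρ π - Real.log ε} := by
  have hm₁ (ω : Ω) : Measurable fun θ => h θ ω := hm.comp measurable_prodMk_right
  have hm₂ (θ : Θ) : Measurable fun ω => h θ ω := hm.comp measurable_prodMk_left
  have hint₁ (ω : Ω) : Integrable (fun θ => Real.exp (h θ ω)) π :=
    Integrable.of_bound (hm₁ ω).exp.aestronglyMeasurable (Real.exp B) <|
      .of_forall fun θ => by
        simpa [abs_of_pos (Real.exp_pos _)] using (abs_le.1 (hB θ ω)).2
  have hint₂ (θ : Θ) : Integrable (fun ω => Real.exp (h θ ω)) P :=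
    Integrable.of_bound (hm₂ θ).exp.aestronglyMeasurable (Real.exp B) <|
      .of_forall fun ω => by
        simpa [abs_of_pos (Real.exp_pos _)] using (abs_le.1 (hB θ ω)).2
  have hmE : Measurable fun p : Ω × Θ => ENNReal.ofReal (Real.exp (h p.2 p.1)) :=
    (hm.comp measurable_swap).exp.ennreal_ofReal
  set W : Ω → ENNReal := fun ω => ∫⁻ θ, ENNReal.ofReal (Real.exp (h θ ω)) ∂π with hW
  have hWm : Measurable W := hmE.lintegral_prod_right'
  have hW1 : ∫⁻ ω, W ω ∂P ≤ 1 := by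
    rw [hW, lintegral_lintegral_swap hmE.aemeasurable]
    calc _ ≤ ∫⁻ _, 1 ∂π := lintegral_mono fun θ => by
            rw [← ofReal_integral_eq_lintegral_ofReal (hint₂ θ)
              (.of_forall fun _ => (Real.exp_pos _).le)]
            exact ENNReal.ofReal_le_one.2 (hexp θ)
      _ = 1 := by simp
  have hε0 : ENNReal.ofReal ε ≠ 0 := by simpa using hε.1
  have hmk : P {ω | (ENNReal.ofReal ε)⁻¹ ≤ W ω} ≤ ENNReal.ofReal ε := by
    have := (mul_meas_ge_le_lintegral hWm (ENNReal.ofReal ε)⁻¹).trans hW1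
    rwa [mul_comm, ← div_eq_mul_inv,
      ENNReal.div_le_iff_le_mul (.inl hε0) (.inl ENNReal.ofReal_ne_top), one_mul] at this
  calc ENNReal.ofReal (1 - ε) = 1 - ENNReal.ofReal ε := by
        rw [ENNReal.ofReal_sub _ hε.1.le, ENNReal.ofReal_one]
    _ ≤ 1 - P {ω | (ENNReal.ofReal ε)⁻¹ ≤ W ω} := tsub_le_tsub_left hmk _
    _ = P {ω | (ENNReal.ofReal ε)⁻¹ ≤ W ω}ᶜ :=
        (prob_compl_eq_one_sub (measurableSet_le measurable_const hWm)).symm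
    _ ≤ _ := by
        refine measure_mono fun ω hω ρ _ hK => ?_
        have hlt : W ω ≤ (ENNReal.ofReal ε)⁻¹ := (not_le.1 (Set.notMem_ofPred_iff.1 hω)).le
        simp only [hW] at hlt
        rw [← ofReal_integral_eq_lintegral_ofReal (hint₁ ω)
          (.of_forall fun _ => (Real.exp_pos _).le), ← ENNReal.ofReal_inv_of_pos hε.1,
          ENNReal.ofReal_le_ofReal_iff (inv_nonneg.2 hε.1.le)] at hlt
        have hdv := integral_le_integral_llr_add_log_integral_exp hK.1
          (Integrable.of_bound (hm₁ ω).aestronglyMeasurable B (.of_forall fun θ => hB θ ω))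
          (hint₁ ω) hK.2
        have hlog := Real.log_le_log (integral_exp_pos (hint₁ ω)) hlt
        rw [Real.log_inv] at hlog
        have : KL ρ π = ∫ θ, llr ρ π θ ∂ρ := rfl
        linarith

lemma integral_log_le_log_integral {ρ : Measure Θ} [IsProbabilityMeasure ρ] {D : Θ → ℝ}
    (hpos : ∀ θ, 0 < D θ) (hD : Integrable D ρ) (hlog : Integrable (fun θ => Real.log (D θ)) ρ) :
    ∫ θ, Real.log (D θ) ∂ρ ≤ Real.log (∫ θ, D θ ∂ρ) := by
  set m := ∫ θ, D θ ∂ρ with hm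
  have hm0 : 0 < m := by
    rw [hm, integral_pos_iff_support_of_nonneg (fun θ => (hpos θ).le) hD]
    have : Function.support D = Set.univ := Set.eq_univ_of_forall fun θ => (hpos θ).ne'
    simp [this]
  calc ∫ θ, Real.log (D θ) ∂ρ ≤ ∫ θ, (Real.log m + (D θ / m - 1)) ∂ρ := by
        refine integral_mono hlog
          ((integrable_const _).add ((hD.div_const m).sub (integrable_const _))) fun θ => ?_
        have := Real.log_le_sub_one_of_pos (div_pos (hpos θ) hm0)
        rw [Real.log_div (hpos θ).ne' hm0.ne'] at this
        simp only
        linarith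
    _ = Real.log m := by
        have hi : Integrable (fun θ => D θ / m - 1) ρ := (hD.div_const m).sub (integrable_const _)
        rw [integral_add (integrable_const _) hi, integral_sub (hD.div_const m) (integrable_const _),
          integral_div, ← hm, div_self hm0.ne']
        simp

end

lemma prod_one_sub_mul_le {N : ℕ} (hN : 0 < N) {c : ℝ} (hc : c ∈ Set.Icc (0 : ℝ) 1)
    {p : Fin N → ℝ} (hp : ∀ i, p i ≤ 1) :
    ∏ i, (1 - c * p i) ≤ (1 - c * ((N : ℝ)⁻¹ * ∑ i, p i)) ^ N := by
  have hN' : (N : ℝ) ≠ 0 := by positivity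
  have hz (i : Fin N) : 0 ≤ 1 - c * p i := by nlinarith [hc.1, hc.2, hp i]
  have h := Real.geom_mean_le_arith_mean_weighted Finset.univ (fun _ : Fin N => (N : ℝ)⁻¹)
    (fun i => 1 - c * p i) (fun _ _ => by positivity) (by simp [hN']) (fun i _ => hz i)
  rw [Real.finsetProd_rpow _ _ (fun i _ => hz i)] at h
  have h2 := pow_le_pow_left₀ (Real.rpow_nonneg (Finset.prod_nonneg fun i _ => hz i) _) h N
  rw [Real.rpow_inv_natCast_pow (Finset.prod_nonneg fun i _ => hz i) hN.ne'] at h2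
  refine h2.trans_eq ?_
  congr 1
  rw [← Finset.mul_sum, Finset.sum_sub_distrib, ← Finset.mul_sum]
  simp
  field_simp

section

variable {𝒳 𝒴 Θ : Type*} {N : ℕ} {f : Θ → 𝒳 → 𝒴}

lemma empErr_mem_Icc [DecidableEq 𝒴]
    (θ : Θ) (ω : Fin N → 𝒳 × 𝒴) : empErr N f θ ω ∈ Set.Icc (0 : ℝ) 1 := by
  rw [empErr, Set.mem_Icc]
  constructor
  · exact mul_nonneg (by positivity) (Finset.sum_nonneg fun i _ => by split_ifs <;> simp)
  · refine inv_mul_le_one_of_le₀ ?_ (by positivity)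
    calc _ ≤ ∑ _i : Fin N, (1 : ℝ) := Finset.sum_le_sum fun i _ => by split_ifs <;> simp
      _ = N := by simp

lemma expErr_mem_Icc [MeasurableSpace 𝒳] [MeasurableSpace 𝒴]
    (P : Measure (Fin N → 𝒳 × 𝒴)) [IsProbabilityMeasure P] (θ : Θ) :
    expErr N P f θ ∈ Set.Icc (0 : ℝ) 1 := by
  rw [expErr, Set.mem_Icc]
  constructor
  · exact mul_nonneg (by positivity) (Finset.sum_nonneg fun i _ => ENNReal.toReal_nonneg)
  · refine inv_mul_le_one_of_le₀ ?_ (by positivity)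
    calc _ ≤ ∑ _i : Fin N, (1 : ℝ) := Finset.sum_le_sum fun i _ => measureReal_le_one
      _ = N := by simp

lemma measurableSet_error [MeasurableSpace 𝒳] [MeasurableSpace 𝒴]
    [Fintype 𝒴] [MeasurableSingletonClass 𝒴] [MeasurableSpace Θ]
    (hf : Measurable fun p : Θ × 𝒳 => f p.1 p.2) :
    MeasurableSet {q : Θ × (𝒳 × 𝒴) | f q.1 q.2.1 = q.2.2} :=
  measurableSet_eq_fun
    (hf.comp (measurable_fst.prodMk (measurable_fst.comp measurable_snd)))
    (measurable_snd.comp measurable_snd)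

lemma measurable_empErr [MeasurableSpace 𝒳] [MeasurableSpace 𝒴]
    [DecidableEq 𝒴] [Fintype 𝒴] [MeasurableSingletonClass 𝒴] [MeasurableSpace Θ]
    (hf : Measurable fun p : Θ × 𝒳 => f p.1 p.2) :
    Measurable fun q : Θ × (Fin N → 𝒳 × 𝒴) => empErr N f q.1 q.2 := by
  unfold empErr
  refine (Finset.measurable_sum _ fun i _ => Measurable.ite ?_ measurable_const
    measurable_const).const_mul _
  have hm : Measurable fun q : Θ × (Fin N → 𝒳 × 𝒴) => (q.1, q.2 i) := by fun_prop
  exact (measurableSet_error hf).preimage hm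

lemma measurable_expErr [MeasurableSpace 𝒳] [MeasurableSpace 𝒴]
    [Fintype 𝒴] [MeasurableSingletonClass 𝒴] [MeasurableSpace Θ]
    (P : Measure (Fin N → 𝒳 × 𝒴)) [IsProbabilityMeasure P]
    (hf : Measurable fun p : Θ × 𝒳 => f p.1 p.2) : Measurable (expErr N P f) := by
  unfold expErr
  refine (Finset.measurable_sum _ fun i _ => Measurable.ennreal_toReal ?_).const_mul _
  have hm : Measurable fun q : Θ × (Fin N → 𝒳 × 𝒴) => (q.1, q.2 i) := by fun_prop
  exact measurable_measure_prodMk_left ((measurableSet_error hf).compl.preimage hm)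

lemma integral_exp_neg_mul_empErr_le [MeasurableSpace 𝒳] [MeasurableSpace 𝒴]
    [DecidableEq 𝒴] [Fintype 𝒴] [MeasurableSingletonClass 𝒴] [MeasurableSpace Θ]
    (hN : 0 < N) (Ps : Fin N → Measure (𝒳 × 𝒴))
    [∀ i, IsProbabilityMeasure (Ps i)] (hf : Measurable fun p : Θ × 𝒳 => f p.1 p.2)
    {lam : ℝ} (hlam : 0 < lam) (θ : Θ) :
    ∫ ω, Real.exp (-(lam * empErr N f θ ω)) ∂Measure.pi Ps ≤
      (1 - (1 - Real.exp (-(lam / N))) * expErr N (Measure.pi Ps) f θ) ^ N := by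
  set a := lam / N with ha
  set c := 1 - Real.exp (-a) with hc
  have ha0 : 0 < a := by positivity
  have hc0 : 0 ≤ c := by
    have : Real.exp (-a) ≤ 1 := Real.exp_le_one_iff.2 (by linarith)
    linarith
  have hc1 : c ≤ 1 := by linarith [Real.exp_pos (-a)]
  set E : Set (𝒳 × 𝒴) := {z | f θ z.1 ≠ z.2} with hE
  have hEm : MeasurableSet E :=
    (measurableSet_error hf).compl.preimage (measurable_prodMk_left (x := θ))
  have hfac (ω : Fin N → 𝒳 × 𝒴) : Real.exp (-(lam * empErr N f θ ω)) =
      ∏ i, (1 - c * E.indicator 1 (ω i)) := by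
    have : -(lam * empErr N f θ ω) =
        ∑ i, -(a * if f θ (ω i).1 = (ω i).2 then 0 else 1) := by
      rw [Finset.sum_neg_distrib, ← Finset.mul_sum, empErr, ha]
      ring
    rw [this, Real.exp_sum]
    refine Finset.prod_congr rfl fun i _ => ?_
    by_cases h : f θ (ω i).1 = (ω i).2 <;> simp [hE, h, hc]
  have hpi (i : Fin N) : (Measure.pi Ps {ω | f θ (ω i).1 ≠ (ω i).2}).toReal = (Ps i).real E := by
    rw [← (measurePreserving_eval Ps i).measureReal_preimage hEm.nullMeasurableSet]
    rfl
  calc _ = ∏ i, ∫ z, (1 - c * E.indicator 1 z) ∂Ps i := by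
        simp_rw [hfac]
        exact integral_fintype_prod_eq_prod (𝕜 := ℝ) fun _ z => 1 - c * E.indicator 1 z
    _ = ∏ i, (1 - c * (Ps i).real E) := Finset.prod_congr rfl fun i _ => by
        have hi : Integrable (E.indicator (1 : 𝒳 × 𝒴 → ℝ)) (Ps i) :=
          (integrable_const (1 : ℝ)).indicator hEm
        rw [integral_sub (integrable_const _) (hi.const_mul c), integral_const_mul,
          integral_indicator_one hEm]
        simp
    _ ≤ _ := by
        simp_rw [expErr, hpi]
        exact prod_one_sub_mul_le hN ⟨hc0, hc1⟩ fun i => measureReal_le_one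

end

/-- Deviation bound (Theorem `thm2.7` of Catoni): for `λ > 0` and `ε ∈ (0,1)`,
with `P`-probability at least `1 - ε`, simultaneously for every probability measure `ρ`
on `Θ` with `K(ρ,π) < ∞`:
`ρ(R) ≤ Φ_{λ/N}⁻¹(ρ(r) + (K(ρ,π) - log ε)/λ)
      ≤ (λ/(N(1 - exp(-λ/N)))) (ρ(r) + (K(ρ,π) - log ε)/λ)`. -/
theorem statement_4 {𝒳 𝒴 Θ : Type*} [MeasurableSpace 𝒳] [MeasurableSpace 𝒴]
    [Fintype 𝒴] [DecidableEq 𝒴] [MeasurableSingletonClass 𝒴] [MeasurableSpace Θ]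
    (N : ℕ) (hN : 0 < N)
    (Ps : Fin N → Measure (𝒳 × 𝒴)) [∀ i, IsProbabilityMeasure (Ps i)]
    (P : Measure (Fin N → 𝒳 × 𝒴)) [IsProbabilityMeasure P] (hP : P = Measure.pi Ps)
    (f : Θ → 𝒳 → 𝒴) (hf : Measurable fun p : Θ × 𝒳 => f p.1 p.2)
    (π : Measure Θ) [IsProbabilityMeasure π] (lam : ℝ) (hlam : 0 < lam)
    (ε : ℝ) (hε : ε ∈ Set.Ioo (0 : ℝ) 1) :
    ENNReal.ofReal (1 - ε) ≤
      P {ω | ∀ ρ : Measure Θ, IsProbabilityMeasure ρ → KLFin ρ π →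
        ((∫ θ, expErr N P f θ ∂ρ)
            ≤ PhiInv (lam / N)
                ((∫ θ, empErr N f θ ω ∂ρ) + (KL ρ π - Real.log ε) / lam))
        ∧ (PhiInv (lam / N) ((∫ θ, empErr N f θ ω ∂ρ) + (KL ρ π - Real.log ε) / lam)
            ≤ (lam / (N * (1 - Real.exp (-(lam / N)))))
                * ((∫ θ, empErr N f θ ω ∂ρ) + (KL ρ π - Real.log ε) / lam))} := by
  subst hP
  set a := lam / N with ha
  set c := 1 - Real.exp (-a) with hc
  have hN' : (0 : ℝ) < N := by positivity
  have ha0 : 0 < a := by positivity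
  have hea : Real.exp (-a) < 1 := Real.exp_lt_one_iff.2 (by linarith)
  have hc0 : 0 < c := by linarith
  have hNa : N * a = lam := by rw [ha]; field_simp
  set P := Measure.pi Ps with hP
  set D : Θ → ℝ := fun θ => 1 - c * expErr N P f θ with hD
  have hDm : Measurable D := ((measurable_expErr P hf).const_mul c).const_sub 1
  have hDle (θ : Θ) : D θ ≤ 1 := by
    have := mul_nonneg hc0.le (expErr_mem_Icc (f := f) P θ).1
    simp only [hD]; linarith
  have hDge (θ : Θ) : Real.exp (-a) ≤ D θ := by
    have := mul_le_mul_of_nonneg_left (expErr_mem_Icc (f := f) P θ).2 hc0.le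
    simp only [hD]; linarith
  have hDpos (θ : Θ) : 0 < D θ := (Real.exp_pos _).trans_le (hDge θ)
  have hlogD (θ : Θ) : |Real.log (D θ)| ≤ a := by
    rw [abs_le]
    exact ⟨(Real.le_log_iff_exp_le (hDpos θ)).2 (hDge θ),
      (Real.log_nonpos (hDpos θ).le (hDle θ)).trans ha0.le⟩
  have hpac := measure_forall_integral_le_KL_sub_log (P := P) (π := π)
    (h := fun θ ω => -(N * Real.log (D θ)) - lam * empErr N f θ ω) (B := N * a + lam)
    ((((hDm.comp measurable_fst).log.const_mul _).neg).sub ((measurable_empErr hf).const_mul _))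
    (fun θ ω => by
      have h₁ := empErr_mem_Icc (f := f) θ ω
      refine (abs_sub _ _).trans (add_le_add ?_ ?_)
      · rw [abs_neg, abs_mul, abs_of_pos hN']
        exact mul_le_mul_of_nonneg_left (hlogD θ) hN'.le
      · rw [abs_mul, abs_of_pos hlam, abs_of_nonneg h₁.1]
        exact mul_le_of_le_one_right hlam.le h₁.2)
    (fun θ => by
      have h₁ (ω : Fin N → 𝒳 × 𝒴) : Real.exp (-(N * Real.log (D θ)) - lam * empErr N f θ ω) =
          (D θ ^ N)⁻¹ * Real.exp (-(lam * empErr N f θ ω)) := by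
        rw [sub_eq_add_neg, Real.exp_add, Real.exp_neg, Real.exp_nat_mul,
          Real.exp_log (hDpos θ)]
      simp_rw [h₁]
      rw [integral_const_mul]
      exact inv_mul_le_one_of_le₀ (integral_exp_neg_mul_empErr_le hN Ps hf hlam θ)
        (pow_nonneg (hDpos θ).le N)) hε
  refine hpac.trans (measure_mono fun ω hω ρ hρ hK => ?_)
  specialize hω ρ hρ hK
  set q := (∫ θ, empErr N f θ ω ∂ρ) + (KL ρ π - Real.log ε) / lam with hq
  have hInv : PhiInv a q = (1 - Real.exp (-(a * q))) / c := by
    rw [PhiInv, if_neg ha0.ne']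
  rw [hInv]
  constructor
  · have hRi : Integrable (expErr N P f) ρ :=
      Integrable.of_bound (measurable_expErr P hf).aestronglyMeasurable 1 (.of_forall fun θ => by
        rw [Real.norm_eq_abs, abs_of_nonneg (expErr_mem_Icc P θ).1]
        exact (expErr_mem_Icc P θ).2)
    have hri : Integrable (fun θ => empErr N f θ ω) ρ :=
      Integrable.of_bound ((measurable_empErr hf).comp
        measurable_prodMk_right).aestronglyMeasurable 1 (.of_forall fun θ => by
          rw [Real.norm_eq_abs, abs_of_nonneg (empErr_mem_Icc θ ω).1]
          exact (empErr_mem_Icc θ ω).2)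
    have hDi : Integrable D ρ := (integrable_const 1).sub (hRi.const_mul c)
    have hlogi : Integrable (fun θ => Real.log (D θ)) ρ :=
      Integrable.of_bound hDm.log.aestronglyMeasurable a (.of_forall hlogD)
    have hDint : ∫ θ, D θ ∂ρ = 1 - c * ∫ θ, expErr N P f θ ∂ρ := by
      simp only [hD]
      rw [integral_sub (integrable_const _) (hRi.const_mul c), integral_const_mul]
      simp
    have hjensen := integral_log_le_log_integral hDpos hDi hlogi
    have hDintpos : 0 < ∫ θ, D θ ∂ρ := by
      refine (Real.exp_pos (-a)).trans_le ?_
      simpa using integral_mono (integrable_const (Real.exp (-a))) hDi hDge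
    have hnlog : Integrable (fun θ => -(N * Real.log (D θ))) ρ := (hlogi.const_mul _).neg
    rw [integral_sub hnlog (hri.const_mul _), integral_neg,
      integral_const_mul, integral_const_mul] at hω
    have haq : N * (a * q) = lam * ∫ θ, empErr N f θ ω ∂ρ + (KL ρ π - Real.log ε) := by
      rw [← mul_assoc, hNa, hq]
      field_simp
    have hlog : -(a * q) ≤ Real.log (∫ θ, D θ ∂ρ) := by
      refine le_trans ?_ hjensen
      refine le_of_mul_le_mul_left ?_ hN'
      linarith
    have := (Real.le_log_iff_exp_le hDintpos).1 hlog
    rw [le_div_iff₀ hc0]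
    linarith
  · have hcoef : lam / (N * c) * q = a * q / c := by
      rw [ha]
      field_simp
    rw [hcoef]
    exact div_le_div_of_nonneg_right (by linarith [Real.add_one_le_exp (-(a * q))]) hc0.le
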